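/- arXiv:2407.09655 — 3 statements merged into one kernel-verified Lean document; each statement's English description precedes it below -/
import Mathlib

section
/- Let π ∈ S_N and x, y ∈ [N], and write t_k = t_k(π). If A(π,x) = {k_1 < k_2 < ⋯ < k_ℓ} are the active locations sorted in increasing order, then π(x) = (k_ℓ t_{k_ℓ})(k_{ℓ−1} t_{k_{ℓ−1}})⋯(k_1 t_{k_1})(x). Similarly, if A^inv(π,y) = {k_1 < ⋯ < k_ℓ} are the inverse-active locations sorted in increasing order, then π^{−1}(y) = (k_1 t_{k_1})(k_2 t_{k_2})⋯(k_ℓ t_{k_ℓ})(y). -/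
/-- Embedding of `Fin (k+1)` into `Fin N` (where `k : Fin N`). -/
def emb {N : ℕ} (k : Fin N) (t : Fin (k.val + 1)) : Fin N :=
  ⟨t.val, lt_of_lt_of_le t.isLt k.isLt⟩

/-- `Phi t = (N t_N)(N−1 t_{N−1})⋯(2 t_2)(1 t_1)`, the strictly monotone factorization map. -/
def Phi {N : ℕ} (t : ∀ k : Fin N, Fin (k.val + 1)) : Equiv.Perm (Fin N) :=
  ((List.finRange N).reverse.map fun k => Equiv.swap k (emb k (t k))).prod

instance {N : ℕ} : Nonempty (∀ k : Fin N, Fin (k.val + 1)) := ⟨fun _ => 0⟩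

/-- `tof π` is the tuple `(t_1(π),…,t_N(π))` of the strictly monotone factorization of `π`. -/
noncomputable def tof {N : ℕ} (π : Equiv.Perm (Fin N)) : ∀ k : Fin N, Fin (k.val + 1) :=
  Function.invFun Phi π

/-- `ptail π k` is `π_{>k} = (N t_N)⋯(k+1 t_{k+1})`. -/
noncomputable def ptail {N : ℕ} (π : Equiv.Perm (Fin N)) (k : Fin N) : Equiv.Perm (Fin N) :=
  (((List.finRange N).reverse.filter fun j => decide (k < j)).map
    fun j => Equiv.swap j (emb j (tof π j))).prod

/-- `phead π k` is `π_{<k} = (k−1 t_{k−1})⋯(1 t_1)`. -/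
noncomputable def phead {N : ℕ} (π : Equiv.Perm (Fin N)) (k : Fin N) : Equiv.Perm (Fin N) :=
  (((List.finRange N).reverse.filter fun j => decide (j < k)).map
    fun j => Equiv.swap j (emb j (tof π j))).prod

/-- `A(π,x)`: the set of locations `k` that are active for `π` and `x`,
i.e. `π_{<k}(x) ∈ {k, t_k(π)}`. -/
noncomputable def activeSet {N : ℕ} (π : Equiv.Perm (Fin N)) (x : Fin N) : Finset (Fin N) :=
  Finset.univ.filter fun k => phead π k x = k ∨ phead π k x = emb k (tof π k)

/-- `A^inv(π,y)`: the set of locations `k` that are inverse-active for `π` and `y`,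
i.e. `(π_{>k})⁻¹(y) ∈ {k, t_k(π)}`. -/
noncomputable def invActiveSet {N : ℕ} (π : Equiv.Perm (Fin N)) (y : Fin N) : Finset (Fin N) :=
  Finset.univ.filter fun k => (ptail π k)⁻¹ y = k ∨ (ptail π k)⁻¹ y = emb k (tof π k)

/-- In a product of permutations indexed by an `r`-sorted list, the factors that fix the image of
`x` under the factors to their right can be dropped when evaluating at `x`. -/
theorem prod_map_apply_eq_prod_map_filter_apply {α β : Type*} (r : α → α → Prop) [DecidableRel r]
    [Std.Asymm r] (f : α → Equiv.Perm β) (p : α → Prop) [DecidablePred p] (x : β) (L : List α)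
    (hL : L.Pairwise r)
    (hp : ∀ k ∈ L, ¬ p k → f k (((L.filter fun j => decide (r k j)).map f).prod x) =
      ((L.filter fun j => decide (r k j)).map f).prod x) :
    (L.map f).prod x = ((L.filter fun k => decide (p k)).map f).prod x := by
  induction L with
  | nil => rfl
  | cons a L ih =>
    obtain ⟨ha, hL⟩ := List.pairwise_cons.1 hL
    have hfil : (a :: L).filter (fun j => decide (r a j)) = L := by
      rw [List.filter_cons_of_neg (by simpa using Std.Irrefl.irrefl a)]
      exact List.filter_eq_self.2 fun b hb => by simpa using ha b hb
    have ih' := ih hL fun k hk hpk => by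
      have h := hp k (List.mem_cons_of_mem a hk) hpk
      rwa [List.filter_cons_of_neg (by simpa using Std.Asymm.asymm _ _ (ha k hk))] at h
    by_cases hpa : p a
    · rw [List.filter_cons_of_pos (by simpa using hpa)]
      simp only [List.map_cons, List.prod_cons, Equiv.Perm.mul_apply, ih']
    · have h := hp a List.mem_cons_self hpa
      rw [hfil] at h
      rw [List.filter_cons_of_neg (by simpa using hpa), ← ih']
      simpa only [List.map_cons, List.prod_cons, Equiv.Perm.mul_apply] using h

/-- A permutation supported on a downward closed set, listed decreasingly, has a strictly monotone
factorization along that list. -/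
theorem exists_prod_map_swap_eq {N : ℕ} (L : List (Fin N)) (hL : L.Pairwise (· > ·))
    (hdown : ∀ a ∈ L, ∀ b < a, b ∈ L) (π : Equiv.Perm (Fin N)) (hπ : ∀ i ∉ L, π i = i) :
    ∃ t : ∀ k : Fin N, Fin (k.val + 1),
      (L.map fun k => Equiv.swap k (emb k (t k))).prod = π := by
  induction L generalizing π with
  | nil => exact ⟨fun _ => 0, Equiv.ext fun i => by simp [hπ i]⟩
  | cons a L ih =>
    obtain ⟨ha, hL⟩ := List.pairwise_cons.1 hL
    have haL : a ∉ L := fun h => lt_irrefl a (ha a h)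
    have hle : π a ≤ a := by
      by_contra! hlt
      have hmem : π a ∉ a :: L := fun h => by
        rcases List.mem_cons.1 h with h | h
        · exact hlt.ne' h
        · exact lt_asymm hlt (ha _ h)
      exact hlt.ne' (π.injective (hπ _ hmem))
    obtain ⟨t, ht⟩ := ih hL
      (fun b hb c hc => by
        rcases List.mem_cons.1 (hdown b (List.mem_cons_of_mem a hb) c hc) with rfl | h
        · exact absurd hc (lt_asymm (ha b hb))
        · exact h)
      (Equiv.swap a (π a) * π)
      (fun i hi => by
        rw [Equiv.Perm.mul_apply]
        by_cases hia : i = a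
        · rw [hia, Equiv.swap_apply_right]
        · have hfix : π i = i := hπ i (by simp [hia, hi])
          have hne : i ≠ π a := fun h => hia (π.injective (hfix.trans h))
          rw [hfix, Equiv.swap_apply_of_ne_of_ne hia hne])
    refine ⟨Function.update t a ⟨(π a).val, Nat.lt_succ_of_le hle⟩, ?_⟩
    have hmap : (L.map fun k => Equiv.swap k (emb k (Function.update t a
        ⟨(π a).val, Nat.lt_succ_of_le hle⟩ k))) =
        L.map fun k => Equiv.swap k (emb k (t k)) :=
      List.map_congr_left fun k hk => by
        rw [Function.update_of_ne (ne_of_mem_of_not_mem hk haL)]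
    rw [List.map_cons, List.prod_cons, hmap, ht, Function.update_self]
    exact Equiv.swap_mul_self_mul a (π a) π

theorem finRange_reverse_pairwise_gt (N : ℕ) : (List.finRange N).reverse.Pairwise (· > ·) :=
  List.pairwise_reverse.2 (List.pairwise_lt_finRange N)

theorem Phi_tof {N : ℕ} (π : Equiv.Perm (Fin N)) : Phi (tof π) = π :=
  Function.invFun_eq (exists_prod_map_swap_eq _ (finRange_reverse_pairwise_gt N)
    (by simp) π (by simp))

theorem sort_filter_univ_eq_filter_finRange {N : ℕ} (p : Fin N → Prop) [DecidablePred p] :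
    (Finset.univ.filter p).sort (· ≤ ·) = (List.finRange N).filter fun k => decide (p k) := by
  refine List.Perm.eq_of_pairwise (le := (· ≤ ·)) (fun a b _ _ => le_antisymm)
    (Finset.pairwise_sort _ _)
    (((List.pairwise_lt_finRange N).imp le_of_lt).filter _) ?_
  exact (List.perm_ext_iff_of_nodup (Finset.sort_nodup _ _)
    ((List.nodup_finRange N).filter _)).2 (by simp)

theorem prod_map_swap_inv {α : Type*} [DecidableEq α] (g : α → α) (L : List α) :
    (L.map fun k => Equiv.swap k (g k)).prod⁻¹ =
      (L.reverse.map fun k => Equiv.swap k (g k)).prod := by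
  rw [List.prod_inv_reverse, List.map_map, List.map_reverse]
  simp [Function.comp_def]

/-- If `A(π,x) = {k_1 < ⋯ < k_ℓ}` (sorted increasingly), then
`π(x) = (k_ℓ t_{k_ℓ})⋯(k_1 t_{k_1})(x)`; similarly, if `A^inv(π,y) = {k_1 < ⋯ < k_ℓ}`, then
`π⁻¹(y) = (k_1 t_{k_1})⋯(k_ℓ t_{k_ℓ})(y)`. -/
theorem stmt5 {N : ℕ} (hN : 1 ≤ N) (π : Equiv.Perm (Fin N)) (x y : Fin N) :
    π x = ((((activeSet π x).sort (· ≤ ·)).reverse.map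
        fun k => Equiv.swap k (emb k (tof π k))).prod) x
    ∧ π⁻¹ y = ((((invActiveSet π y).sort (· ≤ ·)).map
        fun k => Equiv.swap k (emb k (tof π k))).prod) y := by
  constructor
  · conv_lhs => rw [← Phi_tof π]
    rw [activeSet, sort_filter_univ_eq_filter_finRange, ← List.filter_reverse, Phi]
    refine prod_map_apply_eq_prod_map_filter_apply (· > ·) _ _ x _
      (finRange_reverse_pairwise_gt N) fun k _ hk => ?_
    rw [not_or] at hk
    exact Equiv.swap_apply_of_ne_of_ne hk.1 hk.2
  · conv_lhs => rw [← Phi_tof π]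
    rw [invActiveSet, sort_filter_univ_eq_filter_finRange, Phi,
      prod_map_swap_inv (fun k => emb k (tof π k)), List.reverse_reverse]
    refine prod_map_apply_eq_prod_map_filter_apply (· < ·) _ _ y _
      (List.pairwise_lt_finRange N) fun k _ hk => ?_
    rw [not_or, ptail, prod_map_swap_inv (fun k => emb k (tof π k)), ← List.filter_reverse,
      List.reverse_reverse] at hk
    exact Equiv.swap_apply_of_ne_of_ne hk.1 hk.2
end

section
/- Let f : ℕ → ℝ satisfy f(0) = 0 and f(n) = n + (1/n) ∑_{k=0}^{n−1} f(k) for all n ≥ 1. Then f(n) ≤ 2n for all n ≥ 0. -/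
theorem sum_range_two_mul_le (n : ℕ) :
    ∑ k ∈ Finset.range n, 2 * (k : ℝ) ≤ (n : ℝ) * n := by
  induction n with
  | zero => simp
  | succ n ih =>
    rw [Finset.sum_range_succ]
    push_cast
    linarith

/-- If `f : ℕ → ℝ` satisfies `f(0) = 0` and
`f(n) = n + (1/n) ∑_{k=0}^{n−1} f(k)` for all `n ≥ 1`, then `f(n) ≤ 2n` for all `n ≥ 0`. -/
theorem stmt9 (f : ℕ → ℝ) (h0 : f 0 = 0)
    (hrec : ∀ n : ℕ, 1 ≤ n → f n = n + (1 / (n : ℝ)) * ∑ k ∈ Finset.range n, f k) :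
    ∀ n : ℕ, f n ≤ 2 * n := by
  intro n
  induction n using Nat.strong_induction_on with
  | _ n ih =>
    rcases Nat.eq_zero_or_pos n with rfl | hn
    · simp [h0]
    · have hsum : ∑ k ∈ Finset.range n, f k ≤ (n : ℝ) * n :=
        (Finset.sum_le_sum fun k hk => ih k (Finset.mem_range.mp hk)).trans
          (sum_range_two_mul_le n)
      have hn' : (0 : ℝ) < n := Nat.cast_pos.mpr hn
      have hdiv : 1 / (n : ℝ) * ∑ k ∈ Finset.range n, f k ≤ n := by
        rw [one_div_mul_eq_div, div_le_iff₀ hn']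
        exact hsum
      rw [hrec n hn]
      linarith
end

section
/- Let R ⊆ [N] × [N] be a relation; set R_x = {y : (x,y) ∈ R}, R^inv_y = {x : (x,y) ∈ R}, and r_max = max(max_{x∈[N]} |R_x|, max_{y∈[N]} |R^inv_y|). For every q ≥ 1 and every quantum query algorithm making fewer than q queries, the average success probability of producing an input x with (x, π(x)) ∈ R satisfies (1/N!) ∑_{π ∈ S_N} ∑_{x ∈ [N] : (x, π(x)) ∈ R} Pr_π[x] ≤ 914 · q³ · r_max · (ln N + 2)/N. -/
open scoped Classical Kronecker

/-- Bitwise XOR on bit strings `{0,1}^m`. -/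
def bxor {m : ℕ} (a b : Fin m → Bool) : Fin m → Bool := fun i => xor (a i) (b i)

/-- The matrix of the oracle unitary `U^π` on `ℂ^N ⊗ ℂ^N` (with basis `{0,1}^m`),
determined by `U^π|x,y⟩ = |x, y ⊕ π(x)⟩`. -/
noncomputable def oracleM {m : ℕ} (π : Equiv.Perm (Fin m → Bool)) :
    Matrix ((Fin m → Bool) × (Fin m → Bool)) ((Fin m → Bool) × (Fin m → Bool)) ℂ :=
  fun p q => if p.1 = q.1 ∧ p.2 = bxor q.2 (π q.1) then 1 else 0

/-- A quantum query algorithm making `q'` queries to a permutation of `{0,1}^m` and its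
inverse: a finite workspace register `W` with a distinguished element `w0`, unitaries
`U⁽⁰⁾, …, U^{(q')}` on `ℂ^W ⊗ ℂ^N ⊗ ℂ^N`, and for each query a direction (forward or
inverse). -/
structure QueryAlg (m : ℕ) (q' : ℕ) where
  /-- the workspace index set -/
  W : Type
  [fW : Fintype W]
  [dW : DecidableEq W]
  /-- the distinguished initial workspace basis element -/
  w0 : W
  /-- the oracle-independent unitaries -/
  U : Fin (q' + 1) → Matrix (W × (Fin m → Bool) × (Fin m → Bool))
      (W × (Fin m → Bool) × (Fin m → Bool)) ℂ
  unitary : ∀ j, U j ∈ Matrix.unitaryGroup (W × (Fin m → Bool) × (Fin m → Bool)) ℂ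
  /-- direction of each query: `true` = forward, `false` = inverse -/
  fwd : Fin q' → Bool

attribute [instance] QueryAlg.fW QueryAlg.dW

/-- The final state `|ψ_π⟩ = U^{(q')} (I_W ⊗ O_{q'}) ⋯ (I_W ⊗ O_1) U⁽⁰⁾ |w0, 0, 0⟩`,
where `O_j = U^π` for a forward query and `O_j = U^{π⁻¹}` for an inverse query. -/
noncomputable def finalState {m q' : ℕ} (A : QueryAlg m q') (π : Equiv.Perm (Fin m → Bool)) :
    A.W × (Fin m → Bool) × (Fin m → Bool) → ℂ :=
  (((List.ofFn fun j : Fin q' =>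
        A.U j.succ *
          ((1 : Matrix A.W A.W ℂ) ⊗ₖ oracleM (if A.fwd j then π else π⁻¹))).reverse.prod
      * A.U 0).mulVec
    fun p => if p = (A.w0, fun _ => false, fun _ => false) then 1 else 0)

/-- `Pr_π[x]`: the probability that the algorithm outputs `x` (measuring the `X` register),
`∑_{w,y} |⟨w,x,y|ψ_π⟩|²`. -/
noncomputable def outProb {m q' : ℕ} (A : QueryAlg m q') (π : Equiv.Perm (Fin m → Bool))
    (x : Fin m → Bool) : ℝ :=
  ∑ w : A.W, ∑ y : Fin m → Bool, ‖finalState A π (w, x, y)‖ ^ 2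

section Vectors

variable {ι : Type*} [Fintype ι]

/-- The `ℓ²` norm of a vector indexed by a finite type. -/
noncomputable def l2norm (v : ι → ℂ) : ℝ := ‖WithLp.toLp 2 v‖

lemma l2norm_sq (v : ι → ℂ) : l2norm v ^ 2 = ∑ i, ‖v i‖ ^ 2 :=
  EuclideanSpace.norm_sq_eq _

lemma l2norm_nonneg (v : ι → ℂ) : 0 ≤ l2norm v := norm_nonneg _

lemma l2norm_add_le (u v : ι → ℂ) : l2norm (u + v) ≤ l2norm u + l2norm v :=
  norm_add_le (WithLp.toLp 2 u) (WithLp.toLp 2 v)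

lemma l2norm_eq_of_sum_eq {u v : ι → ℂ} (h : ∑ i, ‖u i‖ ^ 2 = ∑ i, ‖v i‖ ^ 2) :
    l2norm u = l2norm v := by
  rw [← l2norm_sq, ← l2norm_sq] at h
  exact (pow_left_inj₀ (l2norm_nonneg _) (l2norm_nonneg _) two_ne_zero).1 h

lemma norm_sq_le_two_mul_add (a b : ℂ) : ‖a‖ ^ 2 ≤ 2 * ‖b‖ ^ 2 + 2 * ‖a - b‖ ^ 2 := by
  have h : ‖a‖ ≤ ‖b‖ + ‖a - b‖ := by
    simpa using norm_add_le b (a - b)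
  nlinarith [norm_nonneg a, norm_nonneg b, norm_nonneg (a - b), sq_nonneg (‖b‖ - ‖a - b‖)]

lemma norm_sub_sq_le (a b : ℂ) : ‖a - b‖ ^ 2 ≤ 2 * ‖a‖ ^ 2 + 2 * ‖b‖ ^ 2 := by
  have h := norm_sub_le a b
  nlinarith [norm_nonneg (a - b), norm_nonneg a, norm_nonneg b, sq_nonneg (‖a‖ - ‖b‖)]

lemma l2norm_unitary_mulVec [DecidableEq ι] {U : Matrix ι ι ℂ}
    (hU : U ∈ Matrix.unitaryGroup ι ℂ) (v : ι → ℂ) : l2norm (U.mulVec v) = l2norm v := by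
  have key (w : ι → ℂ) : ((∑ i, ‖w i‖ ^ 2 : ℝ) : ℂ) = star w ⬝ᵥ w := by
    simp [dotProduct, Complex.conj_mul']
  apply l2norm_eq_of_sum_eq
  have h : star U * U = 1 := (Matrix.mem_unitaryGroup_iff').1 hU
  rw [Matrix.star_eq_conjTranspose] at h
  have : ((∑ i, ‖U.mulVec v i‖ ^ 2 : ℝ) : ℂ) = ((∑ i, ‖v i‖ ^ 2 : ℝ) : ℂ) := by
    rw [key, key, Matrix.star_mulVec, ← Matrix.dotProduct_mulVec, Matrix.mulVec_mulVec, h,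
      Matrix.one_mulVec]
  exact_mod_cast this

/-- The state obtained from `v` by applying `M 0, …, M (k - 1)` in order. -/
noncomputable def evolve (M : ℕ → Matrix ι ι ℂ) (v : ι → ℂ) : ℕ → ι → ℂ
  | 0 => v
  | k + 1 => (M k).mulVec (evolve M v k)

lemma ofFn_reverse_prod_mulVec [DecidableEq ι] (M : ℕ → Matrix ι ι ℂ) (v : ι → ℂ) (k : ℕ) :
    ((List.ofFn fun j : Fin k => M j).reverse.prod).mulVec v = evolve M v k := by
  induction k with
  | zero => simp [evolve]
  | succ k ih =>
    rw [List.ofFn_succ']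
    simp only [List.concat_eq_append, List.reverse_append, List.reverse_cons, List.reverse_nil,
      List.nil_append, List.cons_append, List.prod_cons, Fin.val_last, Fin.val_castSucc, evolve]
    rw [← Matrix.mulVec_mulVec, ih]

lemma l2norm_evolve {M : ℕ → Matrix ι ι ℂ} {k : ℕ}
    (hM : ∀ j < k, ∀ u, l2norm ((M j).mulVec u) = l2norm u) (v : ι → ℂ) :
    l2norm (evolve M v k) = l2norm v := by
  induction k with
  | zero => rfl
  | succ k ih =>
    rw [evolve, hM k k.lt_succ_self, ih fun j hj => hM j (hj.trans k.lt_succ_self)]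

/-- The hybrid argument: two evolutions of the same state differ by at most the sum of the
one-step differences along the first evolution. -/
lemma l2norm_evolve_sub_le {M M' : ℕ → Matrix ι ι ℂ} {k : ℕ}
    (hM' : ∀ j < k, ∀ u, l2norm ((M' j).mulVec u) = l2norm u) (v : ι → ℂ) :
    l2norm (evolve M' v k - evolve M v k) ≤
      ∑ j ∈ Finset.range k,
        l2norm ((M' j).mulVec (evolve M v j) - (M j).mulVec (evolve M v j)) := by
  induction k with
  | zero => simp [evolve, l2norm]
  | succ k ih =>
    rw [Finset.sum_range_succ]
    have h : evolve M' v (k + 1) - evolve M v (k + 1) =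
        (M' k).mulVec (evolve M' v k - evolve M v k) +
          ((M' k).mulVec (evolve M v k) - (M k).mulVec (evolve M v k)) := by
      rw [Matrix.mulVec_sub]
      simp [evolve]
    rw [h]
    refine (l2norm_add_le _ _).trans (add_le_add_left ?_ _)
    rw [hM' k k.lt_succ_self]
    exact ih fun j hj => hM' j (hj.trans k.lt_succ_self)

end Vectors

section Oracle

variable {m : ℕ} {W : Type*} [Fintype W]

lemma bxor_bxor (a b : Fin m → Bool) : bxor (bxor a b) b = a := by
  funext i
  simp [bxor]

/-- XOR with a fixed string, as a permutation. -/
def bxorPerm (c : Fin m → Bool) : Equiv.Perm (Fin m → Bool) where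
  toFun b := bxor b c
  invFun b := bxor b c
  left_inv b := bxor_bxor b c
  right_inv b := bxor_bxor b c

lemma sum_bxor (c : Fin m → Bool) (f : (Fin m → Bool) → ℝ) :
    ∑ b, f (bxor b c) = ∑ b, f b :=
  Equiv.sum_comp (bxorPerm c) f

lemma kronecker_oracleM_mulVec [DecidableEq W] (σ : Equiv.Perm (Fin m → Bool))
    (v : W × (Fin m → Bool) × (Fin m → Bool) → ℂ) (w : W) (a b : Fin m → Bool) :
    ((1 : Matrix W W ℂ) ⊗ₖ oracleM σ).mulVec v (w, a, b) = v (w, a, bxor b (σ a)) := by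
  have hb (c : Fin m → Bool) : b = bxor c (σ a) ↔ c = bxor b (σ a) :=
    ⟨fun h => by rw [h, bxor_bxor], fun h => by rw [h, bxor_bxor]⟩
  rw [Matrix.mulVec, dotProduct, Finset.sum_eq_single (w, a, bxor b (σ a))]
  · simp [Matrix.kroneckerMap_apply, oracleM, bxor_bxor]
  · rintro ⟨w', a', c⟩ - hne
    rw [Matrix.kroneckerMap_apply, Matrix.one_apply]
    by_cases hw : w = w'
    · subst hw
      have : ¬ (a = a' ∧ b = bxor c (σ a')) := by
        rintro ⟨rfl, h⟩
        exact hne (by rw [(hb c).1 h])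
      simp [oracleM, this]
    · simp [hw]
  · simp

/-- The squared norm of the component of `v` whose query register holds `a`. -/
noncomputable def registerMass (v : W × (Fin m → Bool) × (Fin m → Bool) → ℂ)
    (a : Fin m → Bool) : ℝ :=
  ∑ w : W, ∑ b : Fin m → Bool, ‖v (w, a, b)‖ ^ 2

lemma registerMass_nonneg (v : W × (Fin m → Bool) × (Fin m → Bool) → ℂ) (a : Fin m → Bool) :
    0 ≤ registerMass v a := by
  unfold registerMass
  positivity

lemma sum_registerMass (v : W × (Fin m → Bool) × (Fin m → Bool) → ℂ) :
    ∑ a, registerMass v a = l2norm v ^ 2 := by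
  rw [l2norm_sq, Fintype.sum_prod_type]
  simp only [registerMass, Fintype.sum_prod_type]
  exact Finset.sum_comm

lemma registerMass_le_two_mul_add (u v : W × (Fin m → Bool) × (Fin m → Bool) → ℂ)
    (a : Fin m → Bool) :
    registerMass u a ≤ 2 * registerMass v a + 2 * l2norm (u - v) ^ 2 := by
  have h : registerMass u a ≤ 2 * registerMass v a + 2 * registerMass (u - v) a := by
    simp only [registerMass, Finset.mul_sum, ← Finset.sum_add_distrib]
    gcongr
    exact norm_sq_le_two_mul_add _ _
  have h' : registerMass (u - v) a ≤ l2norm (u - v) ^ 2 := by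
    rw [← sum_registerMass]
    exact Finset.single_le_sum (fun a _ => registerMass_nonneg (u - v) a) (Finset.mem_univ a)
  linarith

lemma registerMass_kronecker_oracleM_mulVec [DecidableEq W] (σ : Equiv.Perm (Fin m → Bool))
    (v : W × (Fin m → Bool) × (Fin m → Bool) → ℂ) (a : Fin m → Bool) :
    registerMass (((1 : Matrix W W ℂ) ⊗ₖ oracleM σ).mulVec v) a = registerMass v a := by
  simp only [registerMass, kronecker_oracleM_mulVec]
  exact Finset.sum_congr rfl fun w _ => sum_bxor (σ a) fun b => ‖v (w, a, b)‖ ^ 2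

lemma l2norm_kronecker_oracleM_mulVec [DecidableEq W] (σ : Equiv.Perm (Fin m → Bool))
    (v : W × (Fin m → Bool) × (Fin m → Bool) → ℂ) :
    l2norm (((1 : Matrix W W ℂ) ⊗ₖ oracleM σ).mulVec v) = l2norm v := by
  refine (pow_left_inj₀ (l2norm_nonneg _) (l2norm_nonneg _) two_ne_zero).1 ?_
  simp only [← sum_registerMass, registerMass_kronecker_oracleM_mulVec]

lemma l2norm_oracle_sub_sq_le [DecidableEq W] (σ τ : Equiv.Perm (Fin m → Bool))
    (v : W × (Fin m → Bool) × (Fin m → Bool) → ℂ) {a₁ a₂ : Fin m → Bool}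
    (h : ∀ a, a ≠ a₁ → a ≠ a₂ → σ a = τ a) :
    l2norm (((1 : Matrix W W ℂ) ⊗ₖ oracleM σ).mulVec v -
        ((1 : Matrix W W ℂ) ⊗ₖ oracleM τ).mulVec v) ^ 2 ≤
      4 * (registerMass v a₁ + registerMass v a₂) := by
  set d := ((1 : Matrix W W ℂ) ⊗ₖ oracleM σ).mulVec v -
        ((1 : Matrix W W ℂ) ⊗ₖ oracleM τ).mulVec v with hd
  have hle (a : Fin m → Bool) : registerMass d a ≤ 4 * registerMass v a := by
    have : registerMass d a ≤
        2 * registerMass (((1 : Matrix W W ℂ) ⊗ₖ oracleM σ).mulVec v) a +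
          2 * registerMass (((1 : Matrix W W ℂ) ⊗ₖ oracleM τ).mulVec v) a := by
      simp only [registerMass, Finset.mul_sum, ← Finset.sum_add_distrib]
      gcongr
      exact norm_sub_sq_le _ _
    rw [registerMass_kronecker_oracleM_mulVec, registerMass_kronecker_oracleM_mulVec] at this
    linarith
  have hzero (a : Fin m → Bool) (h₁ : a ≠ a₁) (h₂ : a ≠ a₂) : registerMass d a = 0 := by
    simp [registerMass, hd, kronecker_oracleM_mulVec, h a h₁ h₂]
  have hsub : ∑ a, registerMass d a = ∑ a ∈ {a₁, a₂}, registerMass d a := by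
    refine (Finset.sum_subset (Finset.subset_univ _) fun a _ ha => ?_).symm
    simp only [Finset.mem_insert, Finset.mem_singleton, not_or] at ha
    exact hzero a ha.1 ha.2
  rw [← sum_registerMass, hsub]
  have hv := registerMass_nonneg v
  by_cases h12 : a₁ = a₂
  · subst h12
    simp only [Finset.pair_eq_singleton, Finset.sum_singleton]
    linarith [hle a₁, hv a₁]
  · rw [Finset.sum_pair h12]
    linarith [hle a₁, hle a₂]

end Oracle

namespace QueryAlg

variable {m q' : ℕ} (A : QueryAlg m q')

/-- The `j`-th query followed by the `j + 1`-st oracle-independent unitary. -/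
noncomputable def step (π : Equiv.Perm (Fin m → Bool)) (j : ℕ) :
    Matrix (A.W × (Fin m → Bool) × (Fin m → Bool))
      (A.W × (Fin m → Bool) × (Fin m → Bool)) ℂ :=
  if h : j < q' then
    A.U (Fin.succ ⟨j, h⟩) *
      ((1 : Matrix A.W A.W ℂ) ⊗ₖ oracleM (if A.fwd ⟨j, h⟩ then π else π⁻¹))
  else 1

/-- The state before the first query. -/
noncomputable def initState : A.W × (Fin m → Bool) × (Fin m → Bool) → ℂ :=
  (A.U 0).mulVec fun p => if p = (A.w0, fun _ => false, fun _ => false) then 1 else 0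

/-- The state after `k` queries to `π` and the unitaries that follow them. -/
noncomputable def stateAfter (π : Equiv.Perm (Fin m → Bool)) (k : ℕ) :
    A.W × (Fin m → Bool) × (Fin m → Bool) → ℂ :=
  evolve (A.step π) A.initState k

lemma finalState_eq (π : Equiv.Perm (Fin m → Bool)) :
    finalState A π = A.stateAfter π q' := by
  rw [stateAfter, ← ofFn_reverse_prod_mulVec, finalState, initState, ← Matrix.mulVec_mulVec]
  simp [step]

lemma outProb_eq (π : Equiv.Perm (Fin m → Bool)) (x : Fin m → Bool) :
    outProb A π x = registerMass (A.stateAfter π q') x := by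
  rw [outProb, finalState_eq, registerMass]

lemma l2norm_initState : l2norm A.initState = 1 := by
  rw [initState, l2norm_unitary_mulVec (A.unitary 0)]
  refine (pow_left_inj₀ (l2norm_nonneg _) zero_le_one two_ne_zero).1 ?_
  rw [l2norm_sq, Finset.sum_eq_single (A.w0, fun _ => false, fun _ => false)]
  · simp
  · intro p _ hp
    simp [hp]
  · simp

lemma l2norm_step_mulVec (π : Equiv.Perm (Fin m → Bool)) (j : ℕ)
    (v : A.W × (Fin m → Bool) × (Fin m → Bool) → ℂ) :
    l2norm ((A.step π j).mulVec v) = l2norm v := by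
  unfold step
  split_ifs with h
  all_goals first
    | rw [← Matrix.mulVec_mulVec, l2norm_unitary_mulVec (A.unitary _),
        l2norm_kronecker_oracleM_mulVec]
    | rw [Matrix.one_mulVec]

lemma sum_registerMass_stateAfter (π : Equiv.Perm (Fin m → Bool)) (k : ℕ) :
    ∑ a, registerMass (A.stateAfter π k) a = 1 := by
  rw [sum_registerMass, stateAfter, l2norm_evolve fun j _ => A.l2norm_step_mulVec π j,
    l2norm_initState, one_pow]

/-- The weight that the `j`-th query to `π` puts on points where `π` and
`swap (π x) y * π` (or their inverses, for an inverse query) may differ. -/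
noncomputable def queryWeight (π : Equiv.Perm (Fin m → Bool)) (x y : Fin m → Bool) (j : ℕ) : ℝ :=
  if ∃ h : j < q', A.fwd ⟨j, h⟩ then
    registerMass (A.stateAfter π j) x + registerMass (A.stateAfter π j) (π.symm y)
  else registerMass (A.stateAfter π j) y + registerMass (A.stateAfter π j) (π x)

lemma l2norm_step_sub_sq_le (π : Equiv.Perm (Fin m → Bool)) (x y : Fin m → Bool)
    {j : ℕ} (hj : j < q') :
    l2norm ((A.step (Equiv.swap (π x) y * π) j).mulVec (A.stateAfter π j) -
        (A.step π j).mulVec (A.stateAfter π j)) ^ 2 ≤ 4 * A.queryWeight π x y j := by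
  simp only [step, hj, dite_true]
  rw [← Matrix.mulVec_mulVec, ← Matrix.mulVec_mulVec, ← Matrix.mulVec_sub,
    l2norm_unitary_mulVec (A.unitary _)]
  by_cases hf : A.fwd ⟨j, hj⟩
  · have hw : A.queryWeight π x y j =
        registerMass (A.stateAfter π j) x + registerMass (A.stateAfter π j) (π.symm y) :=
      if_pos ⟨hj, hf⟩
    rw [hw, if_pos hf, if_pos hf]
    refine l2norm_oracle_sub_sq_le _ _ _ fun a hx hy => ?_
    rw [Equiv.Perm.mul_apply, Equiv.swap_apply_of_ne_of_ne (fun h => hx (π.injective h))]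
    rintro rfl
    simp at hy
  · have hw : A.queryWeight π x y j =
        registerMass (A.stateAfter π j) y + registerMass (A.stateAfter π j) (π x) :=
      if_neg fun ⟨_, h⟩ => hf h
    rw [hw, if_neg hf, if_neg hf]
    refine l2norm_oracle_sub_sq_le _ _ _ fun a hy hx => ?_
    rw [mul_inv_rev, Equiv.swap_inv, Equiv.Perm.mul_apply, Equiv.swap_apply_of_ne_of_ne hx hy]

/-- The effect on the output distribution of reprogramming `π` to send `x` to `y`. -/
lemma outProb_swap_mul_le (π : Equiv.Perm (Fin m → Bool)) (x y : Fin m → Bool) :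
    outProb A (Equiv.swap (π x) y * π) x ≤
      2 * outProb A π x + 8 * q' * ∑ j ∈ Finset.range q', A.queryWeight π x y j := by
  rw [outProb_eq, outProb_eq]
  refine (registerMass_le_two_mul_add _ (A.stateAfter π q') x).trans ?_
  have hd := l2norm_evolve_sub_le (M := A.step π) (k := q')
    (fun j _ => A.l2norm_step_mulVec (Equiv.swap (π x) y * π) j) A.initState
  have hsq := (pow_le_pow_left₀ (l2norm_nonneg _) hd 2).trans sq_sum_le_card_mul_sum_sq
  have hsum : ∑ j ∈ Finset.range q',
      l2norm ((A.step (Equiv.swap (π x) y * π) j).mulVec (A.stateAfter π j) -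
        (A.step π j).mulVec (A.stateAfter π j)) ^ 2 ≤
      4 * ∑ j ∈ Finset.range q', A.queryWeight π x y j := by
    rw [Finset.mul_sum]
    exact Finset.sum_le_sum fun j hj => A.l2norm_step_sub_sq_le π x y (Finset.mem_range.1 hj)
  rw [Finset.card_range] at hsq
  have := hsq.trans (mul_le_mul_of_nonneg_left hsum (Nat.cast_nonneg q'))
  simp only [stateAfter] at this ⊢
  linarith

end QueryAlg

section Counting

variable {α : Type*} [Fintype α] [DecidableEq α]

/-- Reprogramming a uniformly random permutation to send `x` to `y` yields a uniformly random
permutation conditioned on sending `x` to `y`. -/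
lemma sum_perm_swap_mul (x y : α) (f : Equiv.Perm α → ℝ) :
    ∑ π : Equiv.Perm α, f (Equiv.swap (π x) y * π) =
      Fintype.card α * ∑ π : Equiv.Perm α, if π x = y then f π else 0 := by
  have h (z : α) : ∑ π : Equiv.Perm α, (if π x = z then f (Equiv.swap z y * π) else 0) =
      ∑ π : Equiv.Perm α, if π x = y then f π else 0 := by
    rw [← Equiv.sum_comp (Equiv.mulLeft (Equiv.swap z y)) fun π => if π x = y then f π else 0]
    refine Finset.sum_congr rfl fun π _ => ?_
    have : (Equiv.swap z y * π) x = y ↔ π x = z := by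
      rw [Equiv.Perm.mul_apply, Equiv.swap_apply_eq_iff, Equiv.swap_apply_right]
    simp only [Equiv.coe_mulLeft, this]
  calc ∑ π : Equiv.Perm α, f (Equiv.swap (π x) y * π)
      = ∑ π : Equiv.Perm α, ∑ z, if π x = z then f (Equiv.swap z y * π) else 0 := by simp
    _ = _ := by
      rw [Finset.sum_comm, Finset.sum_congr rfl fun z _ => h z]
      simp

lemma sum_relation_eq (R : Finset (α × α)) (f : α × α → ℝ) :
    ∑ p ∈ R, f p = ∑ x, ∑ y, if (x, y) ∈ R then f (x, y) else 0 := by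
  rw [← Fintype.sum_prod_type' fun x y => if (x, y) ∈ R then f (x, y) else 0]
  simp

lemma sum_relation_fst_le (R : Finset (α × α)) {r : ℕ}
    (hr : ∀ x, (Finset.univ.filter fun y => (x, y) ∈ R).card ≤ r) {g : α → ℝ}
    (hg : ∀ x, 0 ≤ g x) : ∑ p ∈ R, g p.1 ≤ r * ∑ x, g x := by
  have : ∑ p ∈ R, g p.1 =
      ∑ x, ((Finset.univ.filter fun y => (x, y) ∈ R).card : ℝ) * g x := by
    rw [sum_relation_eq]
    refine Finset.sum_congr rfl fun x _ => ?_
    simp [← Finset.sum_filter]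
  rw [this, Finset.mul_sum]
  gcongr with x
  · exact hg x
  · exact_mod_cast hr x

lemma sum_relation_snd_le (R : Finset (α × α)) {r : ℕ}
    (hr : ∀ y, (Finset.univ.filter fun x => (x, y) ∈ R).card ≤ r) {g : α → ℝ}
    (hg : ∀ x, 0 ≤ g x) : ∑ p ∈ R, g p.2 ≤ r * ∑ x, g x := by
  have : ∑ p ∈ R, g p.2 =
      ∑ y, ((Finset.univ.filter fun x => (x, y) ∈ R).card : ℝ) * g y := by
    rw [sum_relation_eq, Finset.sum_comm]
    refine Finset.sum_congr rfl fun y _ => ?_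
    simp [← Finset.sum_filter]
  rw [this, Finset.mul_sum]
  gcongr with x
  · exact hg x
  · exact_mod_cast hr x

end Counting

lemma QueryAlg.sum_queryWeight_le {m q' : ℕ} (A : QueryAlg m q')
    (R : Finset ((Fin m → Bool) × (Fin m → Bool))) {r : ℕ}
    (hr : ∀ x, (Finset.univ.filter fun y => (x, y) ∈ R).card ≤ r)
    (hr' : ∀ y, (Finset.univ.filter fun x => (x, y) ∈ R).card ≤ r)
    (π : Equiv.Perm (Fin m → Bool)) (j : ℕ) :
    ∑ p ∈ R, A.queryWeight π p.1 p.2 j ≤ 2 * r := by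
  set μ := registerMass (A.stateAfter π j) with hμ
  have hμ0 : ∀ a, 0 ≤ μ a := registerMass_nonneg _
  have hμ1 : ∑ a, μ a = 1 := A.sum_registerMass_stateAfter π j
  unfold queryWeight
  split_ifs
  · rw [Finset.sum_add_distrib]
    have h₁ := sum_relation_fst_le R hr hμ0
    have h₂ := sum_relation_snd_le R hr' (g := fun y => μ (π.symm y)) fun _ => hμ0 _
    rw [Equiv.sum_comp π.symm μ] at h₂
    rw [hμ1] at h₁ h₂
    linarith
  · rw [Finset.sum_add_distrib]
    have h₁ := sum_relation_snd_le R hr' hμ0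
    have h₂ := sum_relation_fst_le R hr (g := fun x => μ (π x)) fun _ => hμ0 _
    rw [Equiv.sum_comp π μ] at h₂
    rw [hμ1] at h₁ h₂
    linarith

/-- A sharper form of the search bound, quadratic in the number of queries. -/
lemma QueryAlg.card_mul_sum_outProb_le {m q' : ℕ} (A : QueryAlg m q')
    (R : Finset ((Fin m → Bool) × (Fin m → Bool))) {r : ℕ}
    (hr : ∀ x, (Finset.univ.filter fun y => (x, y) ∈ R).card ≤ r)
    (hr' : ∀ y, (Finset.univ.filter fun x => (x, y) ∈ R).card ≤ r) :
    (2 : ℝ) ^ m * ∑ π : Equiv.Perm (Fin m → Bool),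
        ∑ x ∈ Finset.univ.filter (fun x : Fin m → Bool => (x, π x) ∈ R), outProb A π x ≤
      ((2 ^ m : ℕ).factorial : ℝ) * (r * (2 + 16 * (q' : ℝ) ^ 2)) := by
  have hsplit (π : Equiv.Perm (Fin m → Bool)) :
      ∑ x ∈ Finset.univ.filter (fun x : Fin m → Bool => (x, π x) ∈ R), outProb A π x =
        ∑ p ∈ R, if π p.1 = p.2 then outProb A π p.1 else 0 := by
    rw [sum_relation_eq, Finset.sum_filter]
    refine Finset.sum_congr rfl fun x _ => ?_
    rw [Finset.sum_eq_single (π x)]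
    · simp
    · intro y _ hy
      simp [hy.symm]
    · simp
  have hcard : (Fintype.card (Fin m → Bool) : ℝ) = 2 ^ m := by simp
  calc _ = ∑ p ∈ R, (Fintype.card (Fin m → Bool) : ℝ) *
          ∑ π : Equiv.Perm (Fin m → Bool), if π p.1 = p.2 then outProb A π p.1 else 0 := by
        rw [Finset.sum_congr rfl fun π _ => hsplit π, Finset.sum_comm, hcard, Finset.mul_sum]
    _ = ∑ π : Equiv.Perm (Fin m → Bool), ∑ p ∈ R,
          outProb A (Equiv.swap (π p.1) p.2 * π) p.1 := by
        rw [Finset.sum_comm]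
        exact Finset.sum_congr rfl fun p _ =>
          (sum_perm_swap_mul p.1 p.2 fun π => outProb A π p.1).symm
    _ ≤ ∑ _π : Equiv.Perm (Fin m → Bool), (r * (2 + 16 * (q' : ℝ) ^ 2)) := by
        refine Finset.sum_le_sum fun π _ => ?_
        have hout : ∑ p ∈ R, outProb A π p.1 ≤ r := by
          simp only [QueryAlg.outProb_eq]
          have h := sum_relation_fst_le R hr (registerMass_nonneg (A.stateAfter π q'))
          rwa [A.sum_registerMass_stateAfter, mul_one] at h
        have hweight : ∑ p ∈ R, ∑ j ∈ Finset.range q', A.queryWeight π p.1 p.2 j ≤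
            q' * (2 * r) := by
          rw [Finset.sum_comm]
          refine (Finset.sum_le_sum fun j _ => A.sum_queryWeight_le R hr hr' π j).trans ?_
          simp
        refine (Finset.sum_le_sum fun p _ => A.outProb_swap_mul_le π p.1 p.2).trans ?_
        rw [Finset.sum_add_distrib, ← Finset.mul_sum, ← Finset.mul_sum]
        have := mul_le_mul_of_nonneg_left hweight (by positivity : (0 : ℝ) ≤ 8 * q')
        linarith
    _ = _ := by
        rw [Finset.sum_const, Finset.card_univ, Fintype.card_perm, nsmul_eq_mul]
        simp

/-- Main theorem, search.  For any relation `R ⊆ [N] × [N]`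
(`N = 2^n`, `[N] ≅ {0,1}^n`) and any quantum query algorithm making fewer than `q`
queries to a random permutation and its inverse, the probability that it outputs `x` with
`(x, π(x)) ∈ R` is at most `914 q³ r_max (ln N + 2)/N`, where
`r_max = max(max_x |R_x|, max_y |R^inv_y|)`. -/
theorem stmt17 {n : ℕ} (hn : 1 ≤ n) (R : Finset ((Fin n → Bool) × (Fin n → Bool)))
    (q q' : ℕ) (hq : 1 ≤ q) (hq' : q' < q) (A : QueryAlg n q') :
    (∑ π : Equiv.Perm (Fin n → Bool),
        ∑ x ∈ Finset.univ.filter (fun x : Fin n → Bool => (x, π x) ∈ R), outProb A π x) /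
        (((2 ^ n : ℕ).factorial : ℝ))
      ≤ 914 * (q : ℝ) ^ 3 *
          ((max
              (Finset.univ.sup fun x : Fin n → Bool =>
                (Finset.univ.filter fun y : Fin n → Bool => (x, y) ∈ R).card)
              (Finset.univ.sup fun y : Fin n → Bool =>
                (Finset.univ.filter fun x : Fin n → Bool => (x, y) ∈ R).card) : ℕ) : ℝ) *
          (Real.log ((2 : ℝ) ^ n) + 2) / (2 : ℝ) ^ n := by
  set r := max
    (Finset.univ.sup fun x : Fin n → Bool =>
      (Finset.univ.filter fun y : Fin n → Bool => (x, y) ∈ R).card)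
    (Finset.univ.sup fun y : Fin n → Bool =>
      (Finset.univ.filter fun x : Fin n → Bool => (x, y) ∈ R).card) with hr
  have hfst (x : Fin n → Bool) : (Finset.univ.filter fun y => (x, y) ∈ R).card ≤ r :=
    (Finset.le_sup (f := fun x : Fin n → Bool =>
      (Finset.univ.filter fun y : Fin n → Bool => (x, y) ∈ R).card)
      (Finset.mem_univ x)).trans (le_max_left _ _)
  have hsnd (y : Fin n → Bool) : (Finset.univ.filter fun x => (x, y) ∈ R).card ≤ r :=
    (Finset.le_sup (f := fun y : Fin n → Bool =>
      (Finset.univ.filter fun x : Fin n → Bool => (x, y) ∈ R).card)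
      (Finset.mem_univ y)).trans (le_max_right _ _)
  have hmain := A.card_mul_sum_outProb_le R hfst hsnd
  have hlog : 0 ≤ Real.log ((2 : ℝ) ^ n) := Real.log_nonneg (one_le_pow₀ one_le_two)
  have hq1 : (1 : ℝ) ≤ q := by exact_mod_cast hq
  have hqq : (q' : ℝ) ≤ q := by exact_mod_cast hq'.le
  have hconst : 2 + 16 * (q' : ℝ) ^ 2 ≤ 914 * (q : ℝ) ^ 3 * (Real.log ((2 : ℝ) ^ n) + 2) := by
    have h₁ : (q' : ℝ) ^ 2 ≤ (q : ℝ) ^ 2 := pow_le_pow_left₀ (Nat.cast_nonneg _) hqq 2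
    have h₂ : (q : ℝ) ^ 2 ≤ (q : ℝ) ^ 3 := pow_le_pow_right₀ hq1 (by norm_num)
    have h₃ : (1 : ℝ) ≤ (q : ℝ) ^ 2 := one_le_pow₀ hq1
    have h₄ : 0 ≤ (q : ℝ) ^ 3 * Real.log ((2 : ℝ) ^ n) := by positivity
    linarith
  have hpos : (0 : ℝ) < ((2 ^ n : ℕ).factorial : ℝ) := by exact_mod_cast Nat.factorial_pos _
  rw [div_le_div_iff₀ hpos (by positivity), mul_comm]
  refine hmain.trans ?_
  have := mul_le_mul_of_nonneg_left hconst (by positivity :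
    (0 : ℝ) ≤ ((2 ^ n : ℕ).factorial : ℝ) * r)
  linarith
end
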